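/- Under Assumption 1, if p ∈ ℝ^n with p ≥ 0 satisfies p = T(p), then every q ∈ ℝ^n with q ≥ 0 and q ≤ T(q) satisfies q ≤ p entrywise. In particular, p is the (unique) maximizer of the linear program: maximize 1^T q over q ∈ ℝ^n subject to q ≥ 0 and q ≤ s + A^T q + Σ_{i=1}^n z_i E_i, where z_i ≤ r_{ij} + B_{ij}^T q for j = 1,…,m_i and z_i ≤ 0. -/

import Mathlib

open Matrix Finset

/-- `minZero v` is the minimum of the entries of `v` and of the scalar `0`. -/
noncomputable def minZero {k : ℕ} (v : Fin k → ℝ) : ℝ :=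
  (insert (0 : ℝ) (Finset.image v Finset.univ)).min' (Finset.insert_nonempty _ _)

/-- The Bellman operator `T(p) = s + Aᵀ p + Σ_i min{r_i + B_iᵀ p, 0} E_i`. -/
noncomputable def bellman {n : ℕ} {m : Fin n → ℕ}
    (A : Matrix (Fin n) (Fin n) ℝ) (B : ∀ i, Matrix (Fin n) (Fin (m i)) ℝ)
    (s : Fin n → ℝ) (r : ∀ i, Fin (m i) → ℝ) (E : Matrix (Fin n) (Fin n) ℝ)
    (p : Fin n → ℝ) : Fin n → ℝ :=
  fun j => s j + (Aᵀ *ᵥ p) j +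
    ∑ i, minZero (fun l => r i l + ((B i)ᵀ *ᵥ p) l) * E i j

/-- Membership in the set 𝒦 of blockwise nonnegative feedback matrices with
full (`1ᵀ K_i = E_iᵀ`) or zero (`1ᵀ K_i = 0`) actuation in each block. -/
def memK {n : ℕ} {m : Fin n → ℕ} (E : Matrix (Fin n) (Fin n) ℝ)
    (K : ∀ i, Matrix (Fin (m i)) (Fin n) ℝ) : Prop :=
  ∀ i, (∀ l j, 0 ≤ K i l j) ∧
    ((∀ j, ∑ l, K i l j = E i j) ∨ (∀ j, ∑ l, K i l j = 0))

/-- Assumption 1: `(A + BK) x ≥ 0` for every `K ∈ 𝒦` and every `x ≥ 0`. -/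
def assumption1 {n : ℕ} {m : Fin n → ℕ}
    (A : Matrix (Fin n) (Fin n) ℝ) (B : ∀ i, Matrix (Fin n) (Fin (m i)) ℝ)
    (E : Matrix (Fin n) (Fin n) ℝ) : Prop :=
  ∀ K : ∀ i, Matrix (Fin (m i)) (Fin n) ℝ, memK E K →
    ∀ x : Fin n → ℝ, 0 ≤ x → 0 ≤ (A + ∑ i, B i * K i) *ᵥ x

/-- The constraint set `U(x) = {u : u ≥ 0, 1ᵀ u_i ≤ E_iᵀ x for all i}`. -/
def inputSet {n : ℕ} {m : Fin n → ℕ} (E : Matrix (Fin n) (Fin n) ℝ)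
    (x : Fin n → ℝ) : Set (∀ i, Fin (m i) → ℝ) :=
  {u | ∀ i, (∀ l, 0 ≤ u i l) ∧ (∑ l, u i l) ≤ ∑ j, E i j * x j}

/-- An admissible trajectory from `x0`: `x(0) = x0`, `u(t) ∈ U(x(t))` and
`x(t+1) = A x(t) + B u(t)`. -/
def admissible {n : ℕ} {m : Fin n → ℕ}
    (A : Matrix (Fin n) (Fin n) ℝ) (B : ∀ i, Matrix (Fin n) (Fin (m i)) ℝ)
    (E : Matrix (Fin n) (Fin n) ℝ) (x0 : Fin n → ℝ)
    (x : ℕ → Fin n → ℝ) (u : ℕ → ∀ i, Fin (m i) → ℝ) : Prop :=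
  x 0 = x0 ∧ ∀ t, u t ∈ inputSet E (x t) ∧
    x (t + 1) = A *ᵥ x t + ∑ i, (B i) *ᵥ (u t i)

/-- The state trajectory generated by a control sequence `u` from `x0`. -/
noncomputable def traj {n : ℕ} {m : Fin n → ℕ}
    (A : Matrix (Fin n) (Fin n) ℝ) (B : ∀ i, Matrix (Fin n) (Fin (m i)) ℝ)
    (x0 : Fin n → ℝ) (u : ℕ → ∀ i, Fin (m i) → ℝ) : ℕ → Fin n → ℝ
  | 0 => x0
  | t + 1 => A *ᵥ traj A B x0 u t + ∑ i, (B i) *ᵥ (u t i)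

/-- Total cost `Σ_{t=0}^∞ [sᵀ x(t) + rᵀ u(t)] ∈ [0,∞]` of a trajectory. -/
noncomputable def trajCost {n : ℕ} {m : Fin n → ℕ}
    (s : Fin n → ℝ) (r : ∀ i, Fin (m i) → ℝ)
    (x : ℕ → Fin n → ℝ) (u : ℕ → ∀ i, Fin (m i) → ℝ) : ENNReal :=
  ∑' t, ENNReal.ofReal ((∑ j, s j * x t j) + ∑ i, ∑ l, r i l * u t i l)

/-- Optimal value `V(x0)`: infimum of the total cost over admissible trajectories. -/
noncomputable def optValue {n : ℕ} {m : Fin n → ℕ}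
    (A : Matrix (Fin n) (Fin n) ℝ) (B : ∀ i, Matrix (Fin n) (Fin (m i)) ℝ)
    (E : Matrix (Fin n) (Fin n) ℝ) (s : Fin n → ℝ) (r : ∀ i, Fin (m i) → ℝ)
    (x0 : Fin n → ℝ) : ENNReal :=
  ⨅ (x : ℕ → Fin n → ℝ) (u : ℕ → ∀ i, Fin (m i) → ℝ)
    (_ : admissible A B E x0 x u), trajCost s r x u

/-- The spectral radius of `M` is strictly less than `1`. -/
def schurStable {n : ℕ} (M : Matrix (Fin n) (Fin n) ℝ) : Prop :=
  ∀ μ ∈ spectrum ℂ (M.map Complex.ofReal), ‖μ‖ < 1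

theorem minZero_nonpos {k : ℕ} (v : Fin k → ℝ) : minZero v ≤ 0 :=
  Finset.min'_le _ _ (Finset.mem_insert_self _ _)

theorem minZero_le_apply {k : ℕ} (v : Fin k → ℝ) (l : Fin k) : minZero v ≤ v l :=
  Finset.min'_le _ _
    (Finset.mem_insert_of_mem (Finset.mem_image_of_mem _ (Finset.mem_univ _)))

theorem le_minZero {k : ℕ} (v : Fin k → ℝ) (z : ℝ) (hz : z ≤ 0) (hv : ∀ l, z ≤ v l) :
    z ≤ minZero v := by
  refine Finset.le_min' _ _ _ fun y hy => ?_
  rcases Finset.mem_insert.1 hy with rfl | hy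
  · exact hz
  · obtain ⟨l, -, rfl⟩ := Finset.mem_image.1 hy
    exact hv l

/-- The value `minZero v` is attained by a nonnegative weight of total mass `0` or `1`, and
pairing this weight with any other vector bounds `minZero` of that vector from above. -/
theorem exists_minZero_weight {k : ℕ} (v : Fin k → ℝ) :
    ∃ σ : Fin k → ℝ, (∀ l, 0 ≤ σ l) ∧ (∑ l, σ l = 1 ∨ ∑ l, σ l = 0) ∧
      (∑ l, σ l * v l = minZero v) ∧ ∀ u : Fin k → ℝ, minZero u ≤ ∑ l, σ l * u l := by
  have hmem : minZero v ∈ insert (0 : ℝ) (Finset.image v Finset.univ) := Finset.min'_mem _ _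
  rcases Finset.mem_insert.1 hmem with h | h
  · exact ⟨0, fun _ => le_rfl, Or.inr (by simp), by simpa using h.symm,
      fun u => by simpa using minZero_nonpos u⟩
  · obtain ⟨l, -, hl⟩ := Finset.mem_image.1 h
    refine ⟨fun a => if a = l then 1 else 0, fun a => ?_, Or.inl (by simp), by simpa using hl,
      fun u => by simpa using minZero_le_apply u l⟩
    dsimp only
    split_ifs <;> norm_num

/-- If `N` is entrywise nonnegative and `p ≥ 0` satisfies `p = c + N p` with `c > 0`, then every
`w` with `w ≤ N w` is nonpositive. -/
theorem nonpos_of_le_mulVec {n : ℕ} (N : Matrix (Fin n) (Fin n) ℝ) (hN : ∀ i j, 0 ≤ N i j)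
    (c p w : Fin n → ℝ) (hc : ∀ j, 0 < c j) (hp : 0 ≤ p)
    (hfix : ∀ j, p j = c j + (N *ᵥ p) j) (hw : ∀ j, w j ≤ (N *ᵥ w) j) : w ≤ 0 := by
  have hpos : ∀ j, 0 < p j := fun j => by
    have h : 0 ≤ (N *ᵥ p) j :=
      Finset.sum_nonneg (s := Finset.univ) (f := fun i => N j i * p i) fun i _ => mul_nonneg (hN j i) (hp i)
    linarith [hfix j, hc j]
  intro a
  by_contra! ha
  simp only [Pi.zero_apply] at ha
  obtain ⟨j, -, hj⟩ := Finset.exists_max_image Finset.univ (fun i => w i / p i) ⟨a, mem_univ a⟩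
  set θ := w j / p j with hθ
  have hθpos : 0 < θ := (div_pos ha (hpos a)).trans_le (hj a (mem_univ a))
  have hle : ∀ i, w i ≤ θ * p i := fun i => (div_le_iff₀ (hpos i)).1 (hj i (mem_univ i))
  have hwj : w j = θ * p j := by rw [hθ, div_mul_cancel₀ _ (hpos j).ne']
  have hNw : (N *ᵥ w) j ≤ θ * (N *ᵥ p) j := by
    simp only [mulVec, dotProduct, Finset.mul_sum]
    refine Finset.sum_le_sum fun i _ => ?_
    calc N j i * w i ≤ N j i * (θ * p i) := mul_le_mul_of_nonneg_left (hle i) (hN j i)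
      _ = θ * (N j i * p i) := by ring
  nlinarith [hw j, hfix j, mul_pos hθpos (hc j)]

/-- Evaluation of the policy `K_i = σ_i E_iᵀ` at a cost vector `q`. -/
theorem policy_evaluation {n : ℕ} {m : Fin n → ℕ}
    (A : Matrix (Fin n) (Fin n) ℝ) (B : ∀ i, Matrix (Fin n) (Fin (m i)) ℝ)
    (s : Fin n → ℝ) (r : ∀ i, Fin (m i) → ℝ) (E : Matrix (Fin n) (Fin n) ℝ)
    (σ : ∀ i, Fin (m i) → ℝ) (q : Fin n → ℝ) (j : Fin n) :
    s j + (Aᵀ *ᵥ q) j + ∑ i, (∑ l, σ i l * (r i l + ((B i)ᵀ *ᵥ q) l)) * E i j =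
      (s j + ∑ i, (∑ l, σ i l * r i l) * E i j) +
        ((A + ∑ i, B i * Matrix.of fun l b => σ i l * E i b)ᵀ *ᵥ q) j := by
  have hK : ∀ i, ((B i * Matrix.of fun l b => σ i l * E i b)ᵀ *ᵥ q) j =
      (∑ l, σ i l * ((B i)ᵀ *ᵥ q) l) * E i j := fun i => by
    rw [transpose_mul, ← mulVec_mulVec, Finset.sum_mul]
    simp only [mulVec, dotProduct, transpose_apply, of_apply]
    refine Finset.sum_congr rfl fun l _ => ?_
    ring
  rw [transpose_add, transpose_sum, add_mulVec, sum_mulVec, Pi.add_apply, Finset.sum_apply]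
  simp only [hK, mul_add, Finset.sum_add_distrib, add_mul]
  ring

/-- A nonnegative fixed point of the Bellman operator dominates every subsolution. -/
theorem le_of_le_bellman {n : ℕ} {m : Fin n → ℕ}
    (A : Matrix (Fin n) (Fin n) ℝ) (B : ∀ i, Matrix (Fin n) (Fin (m i)) ℝ)
    (s : Fin n → ℝ) (r : ∀ i, Fin (m i) → ℝ) (E : Matrix (Fin n) (Fin n) ℝ)
    (hs : ∀ j, 0 < s j) (hr : ∀ i l, 0 ≤ r i l) (hE : ∀ i j, 0 ≤ E i j)
    (hA1 : assumption1 A B E)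
    (p : Fin n → ℝ) (hp : 0 ≤ p) (hfix : p = bellman A B s r E p)
    (q : Fin n → ℝ) (hq : q ≤ bellman A B s r E q) : q ≤ p := by
  choose σ hσ hσsum hσp hσu using
    fun i => exists_minZero_weight (fun l => r i l + ((B i)ᵀ *ᵥ p) l)
  set M := A + ∑ i, B i * Matrix.of fun l b => σ i l * E i b with hM
  have hmem : memK E fun i => Matrix.of fun l b => σ i l * E i b := fun i => by
    refine ⟨fun l j => mul_nonneg (hσ i l) (hE i j), (hσsum i).imp ?_ ?_⟩ <;> intro h j <;>
      simp [← Finset.sum_mul, h]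
  have hMnn : ∀ a b, 0 ≤ Mᵀ a b := fun a b => by
    have h := hA1 _ hmem (Pi.single a 1) (Pi.single_nonneg.2 zero_le_one) b
    simpa [← hM] using h
  have hc : ∀ j, 0 < s j + ∑ i, (∑ l, σ i l * r i l) * E i j := fun j =>
    add_pos_of_pos_of_nonneg (hs j) <| Finset.sum_nonneg fun i _ =>
      mul_nonneg (Finset.sum_nonneg fun l _ => mul_nonneg (hσ i l) (hr i l)) (hE i j)
  have hpM : ∀ j, p j = (s j + ∑ i, (∑ l, σ i l * r i l) * E i j) + (Mᵀ *ᵥ p) j := fun j => by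
    rw [hM, ← policy_evaluation]
    simpa only [bellman, hσp] using congrFun hfix j
  have hqM : ∀ j, q j ≤ (s j + ∑ i, (∑ l, σ i l * r i l) * E i j) + (Mᵀ *ᵥ q) j := fun j => by
    rw [hM, ← policy_evaluation]
    refine (hq j).trans (add_le_add_right (Finset.sum_le_sum fun i _ => ?_) _)
    exact mul_le_mul_of_nonneg_right (hσu i _) (hE i j)
  refine sub_nonpos.1 (nonpos_of_le_mulVec Mᵀ hMnn _ p (q - p) hc hp hpM fun j => ?_)
  rw [mulVec_sub, Pi.sub_apply, Pi.sub_apply]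
  linarith [hpM j, hqM j]

/-- under Assumption 1, a nonnegative fixed point `p = T(p)` dominates
every `q ≥ 0` with `q ≤ T(q)`; in particular `p` is feasible for, and is the unique
maximizer of, the linear program maximizing `1ᵀ q` subject to `q ≥ 0`,
`q ≤ s + Aᵀ q + Σ_i z_i E_i`, `z_i ≤ r_{ij} + B_{ij}ᵀ q`, `z_i ≤ 0`. -/
theorem stmt_7 {n : ℕ} {m : Fin n → ℕ}
    (A : Matrix (Fin n) (Fin n) ℝ) (B : ∀ i, Matrix (Fin n) (Fin (m i)) ℝ)
    (s : Fin n → ℝ) (r : ∀ i, Fin (m i) → ℝ) (E : Matrix (Fin n) (Fin n) ℝ)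
    (hs : ∀ j, 0 < s j) (hr : ∀ i l, 0 ≤ r i l)
    (hE : ∀ i j, 0 ≤ E i j) (hEinv : IsUnit E.det)
    (hA1 : assumption1 A B E)
    (p : Fin n → ℝ) (hp : 0 ≤ p) (hfix : p = bellman A B s r E p) :
    (∀ q : Fin n → ℝ, 0 ≤ q → q ≤ bellman A B s r E q → q ≤ p) ∧
    (∃ z : Fin n → ℝ, (∀ i, z i ≤ 0) ∧
      (∀ i (j : Fin (m i)), z i ≤ r i j + ((B i)ᵀ *ᵥ p) j) ∧
      (∀ j, p j ≤ s j + (Aᵀ *ᵥ p) j + ∑ i, z i * E i j)) ∧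
    (∀ q z : Fin n → ℝ, 0 ≤ q → (∀ i, z i ≤ 0) →
      (∀ i (j : Fin (m i)), z i ≤ r i j + ((B i)ᵀ *ᵥ q) j) →
      (∀ j, q j ≤ s j + (Aᵀ *ᵥ q) j + ∑ i, z i * E i j) →
      (∑ j, q j) ≤ (∑ j, p j) ∧ ((∑ j, q j) = (∑ j, p j) → q = p)) := by
  have hdom := le_of_le_bellman A B s r E hs hr hE hA1 p hp hfix
  refine ⟨fun q _ hq => hdom q hq,
    ⟨fun i => minZero (fun l => r i l + ((B i)ᵀ *ᵥ p) l), fun i => minZero_nonpos _,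
      fun i j => minZero_le_apply (fun l => r i l + ((B i)ᵀ *ᵥ p) l) j,
      fun j => (congrFun hfix j).le⟩,
    fun q z _ hz0 hz hqz => ?_⟩
  have hqp : q ≤ p := hdom q fun j => (hqz j).trans <|
    add_le_add_right (Finset.sum_le_sum fun i _ =>
      mul_le_mul_of_nonneg_right (le_minZero _ _ (hz0 i) (hz i)) (hE i j)) _
  refine ⟨Finset.sum_le_sum fun j _ => hqp j, fun heq => funext fun j => ?_⟩
  exact (Finset.sum_eq_sum_iff_of_le fun j _ => hqp j).1 heq j (mem_univ j)
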